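/- Let q ≥ 4 be a prime power. For the Veronese code C_q, the number of 1-dimensional subcodes of each weight is: A_{q^2−q}^(1) = (q^4+2q^3+2q^2+q)/2, A_{q^2}^(1) = q^5+q+1, A_{q^2+q}^(1) = (q^4−q)/2, and A_w^(1) = 0 for every other weight w. -/

import Mathlib

noncomputable section

open MvPolynomial

/-- The projective plane over `F`: the projectivization of `F^3`. -/
abbrev Plane (F : Type*) [Field F] := Projectivization F (Fin 3 → F)

/-- The Veronese code: evaluations of homogeneous degree-2 polynomials at the
chosen representatives of the points of the projective plane. -/
def VeroneseCode {F : Type*} [Field F] (rep : Plane F → (Fin 3 → F)) :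
    Submodule F (Plane F → F) :=
  (MvPolynomial.homogeneousSubmodule (Fin 3) F 2).map
    (LinearMap.pi fun p => (MvPolynomial.aeval (rep p)).toLinearMap)

/-- The (Hamming) weight of a word: the size of its support. -/
def wt {α K : Type*} [Zero K] (g : α → K) : ℕ := Nat.card {p | g p ≠ 0}

/-- The weight of a subcode: the size of the union of supports of its elements. -/
def wtSub {F α : Type*} [Field F] (D : Submodule F (α → F)) : ℕ :=
  Nat.card {p | ∃ c ∈ D, c p ≠ 0}

/-- The higher weight spectrum `A_w^(r)`: the number of subspaces of the Veronese
code of dimension `r` and weight `w`. -/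
def hwSpectrum {F : Type*} [Field F] (rep : Plane F → (Fin 3 → F)) (r w : ℕ) : ℕ :=
  Nat.card {D : Submodule F (Plane F → F) //
    D ≤ VeroneseCode rep ∧ Module.finrank F ↥D = r ∧ wtSub D = w}

/-- Explicit ternary quadratic form with coefficient vector `a`. -/
def qf {F : Type*} [Field F] (a : Fin 6 → F) (x : Fin 3 → F) : F :=
  a 0 * x 0 ^ 2 + a 1 * x 1 ^ 2 + a 2 * x 2 ^ 2 + a 3 * (x 0 * x 1) + a 4 * (x 0 * x 2)
    + a 5 * (x 1 * x 2)

section counting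
open Classical
set_option linter.unusedSectionVars false
set_option linter.unusedSimpArgs false

variable {F : Type*} [Field F] [Fintype F]

lemma sum_lin (l m : F) :
    (∑ x : F, if x * l + m = 0 then 1 else 0) =
      if l ≠ 0 then 1 else if m = 0 then Fintype.card F else 0 := by
  by_cases hl : l = 0
  · subst hl
    by_cases hm : m = 0 <;> simp [hm]
  · have : ∀ x : F, x * l + m = 0 ↔ x = -m / l := by
      intro x
      rw [eq_div_iff hl, eq_neg_iff_add_eq_zero]
    simp [this, hl]

lemma sum_split (z0 : F) (h : F → ℕ) (c : ℕ) (hc : ∀ z, z ≠ z0 → h z = c) :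
    ∑ z, h z = (Fintype.card F - 1) * c + h z0 := by
  rw [← Finset.sum_erase_add _ _ (Finset.mem_univ z0)]
  congr 1
  rw [Finset.sum_congr rfl (g := fun _ => c)]
  · simp [Finset.card_erase_of_mem]
  · intro x hx
    exact hc x (Finset.ne_of_mem_erase hx)

lemma quad_roots (b c f : F) (hb : b ≠ 0) :
    (∑ t : F, if b * t ^ 2 + f * t + c = 0 then 1 else 0) ∈ ({0, 1, 2} : Set ℕ) := by
  rw [← Finset.card_filter]
  by_cases h : ∃ t0 : F, b * t0 ^ 2 + f * t0 + c = 0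
  · obtain ⟨t0, h0⟩ := h
    have : (Finset.univ.filter fun t : F => b * t ^ 2 + f * t + c = 0)
        = {t0, -f / b - t0} := by
      ext t
      simp only [Finset.mem_filter, Finset.mem_univ, true_and, Finset.mem_insert,
        Finset.mem_singleton]
      have key : b * t ^ 2 + f * t + c = b * ((t - t0) * (t - (-f / b - t0))) := by
        field_simp
        linear_combination h0
      rw [key]
      simp [hb, sub_eq_zero]
    rw [this]
    by_cases e : t0 = -f / b - t0
    · rw [← e]; simp
    · rw [Finset.card_pair e]; simp
  · push Not at h
    simp [h]

lemma binary_count (b c f : F) :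
    (b = 0 ∧ c = 0 ∧ f = 0) ∨
    (∑ z : F, ∑ y : F, if b * y ^ 2 + c * z ^ 2 + f * (y * z) = 0 then 1 else 0) ∈
      ({1, Fintype.card F, 2 * Fintype.card F - 1} : Set ℕ) := by
  have hq : 1 < Fintype.card F := Fintype.one_lt_card
  rw [sum_split 0 _ (∑ t : F, if b * t ^ 2 + f * t + c = 0 then 1 else 0)]
  · by_cases hb : b = 0
    · subst hb
      by_cases hf : f = 0
      · subst hf
        by_cases hc : c = 0
        · simp [hc]
        · right; simp [hc]
      · right
        have := sum_lin f c
        simp only [mul_comm _ f] at this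
        simp [this, hf]
        omega
    · right
      have h1 : (∑ y : F, if b * y ^ 2 + c * 0 ^ 2 + f * (y * 0) = 0 then 1 else 0) = 1 := by
        simp [hb]
      rw [h1]
      have := quad_roots b c f hb
      simp only [Set.mem_insert_iff, Set.mem_singleton_iff] at this ⊢
      rcases this with h | h | h <;> rw [h] <;> omega
  · intro z hz
    symm
    apply Fintype.sum_equiv (Equiv.mulRight₀ z hz)
    intro t
    have : b * ((Equiv.mulRight₀ z hz) t) ^ 2 + c * z ^ 2 + f * ((Equiv.mulRight₀ z hz) t * z)
      = z ^ 2 * (b * t ^ 2 + f * t + c) := by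
      simp; ring
    rw [this]
    simp [hz]

lemma ternary_count (b c d e f : F) :
    (b = 0 ∧ c = 0 ∧ d = 0 ∧ e = 0 ∧ f = 0) ∨
    (∑ y : F, ∑ z : F, ∑ x : F,
      if x * (d * y + e * z) + (b * y ^ 2 + c * z ^ 2 + f * (y * z)) = 0 then 1 else 0) ∈
      ({Fintype.card F, Fintype.card F ^ 2, 2 * Fintype.card F ^ 2 - Fintype.card F} : Set ℕ) := by
  have hq : 1 < Fintype.card F := Fintype.one_lt_card
  simp only [sum_lin]
  by_cases he : e = 0
  · subst he
    by_cases hd : d = 0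
    · subst hd
      rcases binary_count b c f with h | h
      · left; simp [h]
      · right
        have e1 : (∑ y : F, ∑ z : F, if (0 : F) * y + 0 * z ≠ 0 then 1 else
          if b * y ^ 2 + c * z ^ 2 + f * (y * z) = 0 then Fintype.card F else 0)
          = Fintype.card F * (∑ z : F, ∑ y : F,
            if b * y ^ 2 + c * z ^ 2 + f * (y * z) = 0 then 1 else 0) := by
          rw [Finset.sum_comm]
          simp only [Finset.mul_sum, mul_ite, mul_one, mul_zero, zero_mul, add_zero, ne_eq,
            not_true_eq_false, if_false]
        rw [e1]
        simp only [Set.mem_insert_iff, Set.mem_singleton_iff] at h ⊢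
        rcases h with h | h | h <;> rw [h]
        · simp
        · right; left; ring
        · right; right
          rw [Nat.mul_sub]; ring_nf
    · right
      rw [sum_split 0 _ (Fintype.card F)]
      · by_cases hc : c = 0
        · subst hc
          simp
          right; right
          zify [show 1 ≤ Fintype.card F by omega,
            show Fintype.card F ≤ 2 * Fintype.card F ^ 2 by nlinarith]
          ring
        · simp [hc]
          right; left
          zify [show 1 ≤ Fintype.card F by omega]
          ring
      · intro y hy
        simp [hd, hy]
  · right
    have key : ∀ y : F, (∑ z : F, if d * y + e * z ≠ 0 then 1 else
          if b * y ^ 2 + c * z ^ 2 + f * (y * z) = 0 then Fintype.card F else 0)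
        = (Fintype.card F - 1) + if y ^ 2 * (b * e ^ 2 + c * d ^ 2 - f * d * e) = 0 then
          Fintype.card F else 0 := by
      intro y
      rw [sum_split (-(d * y) / e) _ 1]
      · have h1 : d * y + e * (-(d * y) / e) = 0 := by field_simp; ring
        have h2 : b * y ^ 2 + c * (-(d * y) / e) ^ 2 + f * (y * (-(d * y) / e))
          = y ^ 2 * (b * e ^ 2 + c * d ^ 2 - f * d * e) / e ^ 2 := by
          field_simp; ring
        rw [h1, h2]
        simp [he]
      · intro z hz
        rw [if_pos]
        intro h
        apply hz
        rw [eq_div_iff he]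
        linear_combination h
    simp only [key]
    rw [Finset.sum_add_distrib]
    by_cases hk : b * e ^ 2 + c * d ^ 2 - f * d * e = 0
    · simp [hk]
      right; right
      zify [show 1 ≤ Fintype.card F by omega,
            show Fintype.card F ≤ 2 * Fintype.card F ^ 2 by nlinarith]
      ring
    · simp [hk]
      right; left
      zify [show 1 ≤ Fintype.card F by omega]
      ring

lemma count_basis (a : Fin 6 → F) (v u w : Fin 3 → F) (hv : qf a v = 0)
    (hinj : ∀ x y z : F, x • v + y • u + z • w = 0 → x = 0 ∧ y = 0 ∧ z = 0) :
    (∀ x, qf a x = 0) ∨ (∑ x, if qf a x = 0 then 1 else 0) ∈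
      ({Fintype.card F, Fintype.card F ^ 2, 2 * Fintype.card F ^ 2 - Fintype.card F} : Set ℕ) := by
  let T : F × F × F → (Fin 3 → F) := fun p => p.2.2 • v + p.1 • u + p.2.1 • w
  have hT : Function.Bijective T := by
    rw [Fintype.bijective_iff_injective_and_card]
    constructor
    · rintro ⟨y, z, x⟩ ⟨y', z', x'⟩ h
      have := hinj (x - x') (y - y') (z - z') (by
        have h' : x • v + y • u + z • w = x' • v + y' • u + z' • w := h
        rw [sub_smul, sub_smul, sub_smul]
        linear_combination h')
      simp only [sub_eq_zero] at this
      obtain ⟨h1, h2, h3⟩ := this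
      simp [h1, h2, h3]
    · simp [Fintype.card_prod]; ring
  let P : (Fin 3 → F) → (Fin 3 → F) → F := fun v u =>
    2 * a 0 * v 0 * u 0 + 2 * a 1 * v 1 * u 1 + 2 * a 2 * v 2 * u 2
      + a 3 * (v 0 * u 1 + v 1 * u 0) + a 4 * (v 0 * u 2 + v 2 * u 0)
      + a 5 * (v 1 * u 2 + v 2 * u 1)
  have hQ : ∀ p : F × F × F, qf a (T p) = p.2.2 * (P v u * p.1 + P v w * p.2.1) +
      (qf a u * p.1 ^ 2 + qf a w * p.2.1 ^ 2 + P u w * (p.1 * p.2.1)) := by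
    rintro ⟨y, z, x⟩
    simp only [qf, T, P, Pi.add_apply, Pi.smul_apply, smul_eq_mul] at hv ⊢
    linear_combination x ^ 2 * hv
  have hsum : (∑ x, if qf a x = 0 then 1 else 0) = ∑ y : F, ∑ z : F, ∑ x : F,
      if x * (P v u * y + P v w * z) + (qf a u * y ^ 2 + qf a w * z ^ 2 + P u w * (y * z)) = 0
        then 1 else 0 := by
    rw [← (Equiv.ofBijective T hT).sum_comp]
    simp only [Equiv.ofBijective_apply, hQ, Fintype.sum_prod_type]
  rw [hsum]
  rcases ternary_count (qf a u) (qf a w) (P v u) (P v w) (P u w) with ⟨h1, h2, h3, h4, h5⟩ | h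
  · left
    intro x
    obtain ⟨p, rfl⟩ := hT.2 x
    rw [hQ, h1, h2, h3, h4, h5]
    simp
  · right; exact h

/-- The polynomial of a quadratic form. -/
def qpoly (a : Fin 6 → F) : MvPolynomial (Fin 3) F :=
  C (a 0) * X 0 ^ 2 + C (a 1) * X 1 ^ 2 + C (a 2) * X 2 ^ 2 + C (a 3) * (X 0 * X 1)
    + C (a 4) * (X 0 * X 2) + C (a 5) * (X 1 * X 2)

lemma qpoly_hom (a : Fin 6 → F) : (qpoly a).IsHomogeneous 2 := by
  have hX : ∀ i : Fin 3, (X i ^ 2 : MvPolynomial (Fin 3) F).IsHomogeneous 2 := fun i => by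
    simpa using (isHomogeneous_X F i).pow 2
  have hXY : ∀ i j : Fin 3, (X i * X j : MvPolynomial (Fin 3) F).IsHomogeneous 2 := fun i j =>
    (isHomogeneous_X F i).mul (isHomogeneous_X F j)
  have hC : ∀ (c : F) (p : MvPolynomial (Fin 3) F), p.IsHomogeneous 2 →
      (C c * p).IsHomogeneous 2 := fun c p hp => by
    simpa using (isHomogeneous_C (Fin 3) c).mul hp
  unfold qpoly
  refine (((((hC _ _ (hX 0)).add (hC _ _ (hX 1))).add (hC _ _ (hX 2))).add
    (hC _ _ (hXY _ _))).add (hC _ _ (hXY _ _))).add (hC _ _ (hXY _ _))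

lemma aeval_qpoly (a : Fin 6 → F) (x : Fin 3 → F) : aeval x (qpoly a) = qf a x := by
  simp [qpoly, qf]

lemma exists_zero (a : Fin 6 → F) : ∃ v, v ≠ 0 ∧ qf a v = 0 := by
  by_contra! h
  have hp := char_dvd_card_solutions (ringChar F) (f := qpoly a)
    (by have := (qpoly_hom a).totalDegree_le; simp; omega)
  have h1 : Fintype.card {x : Fin 3 → F // eval x (qpoly a) = 0} = 1 := by
    rw [Fintype.card_eq_one_iff]
    refine ⟨⟨0, ?_⟩, ?_⟩
    · rw [← aeval_eq_eval, aeval_qpoly]; simp [qf]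
    · rintro ⟨x, hx⟩
      rw [← aeval_eq_eval, aeval_qpoly] at hx
      by_contra h'
      exact h x (fun e => h' (by simp [e])) hx
  rw [h1] at hp
  have : (ringChar F) = 1 := Nat.dvd_one.mp hp
  exact CharP.ringChar_ne_one this

lemma affine_count (a : Fin 6 → F) :
    (∀ x, qf a x = 0) ∨ (∑ x, if qf a x = 0 then 1 else 0) ∈
      ({Fintype.card F, Fintype.card F ^ 2, 2 * Fintype.card F ^ 2 - Fintype.card F} : Set ℕ) := by
  obtain ⟨v, hv0, hv⟩ := exists_zero a
  have : v 0 ≠ 0 ∨ v 1 ≠ 0 ∨ v 2 ≠ 0 := by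
    by_contra! h
    apply hv0
    ext i
    fin_cases i <;> simp [h]
  rcases this with h | h | h
  · apply count_basis a v ![0, 1, 0] ![0, 0, 1] hv
    intro x y z H
    have H0 := congrFun H 0
    have H1 := congrFun H 1
    have H2 := congrFun H 2
    simp only [Pi.add_apply, Pi.smul_apply, smul_eq_mul, Pi.zero_apply] at H0 H1 H2
    simp [h] at H0 H1 H2
    simp_all
  · apply count_basis a v ![1, 0, 0] ![0, 0, 1] hv
    intro x y z H
    have H0 := congrFun H 0
    have H1 := congrFun H 1
    have H2 := congrFun H 2
    simp only [Pi.add_apply, Pi.smul_apply, smul_eq_mul, Pi.zero_apply] at H0 H1 H2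
    simp [h] at H0 H1 H2
    simp_all
  · apply count_basis a v ![1, 0, 0] ![0, 1, 0] hv
    intro x y z H
    have H0 := congrFun H 0
    have H1 := congrFun H 1
    have H2 := congrFun H 2
    simp only [Pi.add_apply, Pi.smul_apply, smul_eq_mul, Pi.zero_apply] at H0 H1 H2
    simp [h] at H0 H1 H2
    simp_all

lemma qf_eq_zero (a : Fin 6 → F) (h : ∀ x, qf a x = 0) : a = 0 := by
  have h0 := h ![1, 0, 0]
  have h1 := h ![0, 1, 0]
  have h2 := h ![0, 0, 1]
  have h3 := h ![1, 1, 0]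
  have h4 := h ![1, 0, 1]
  have h5 := h ![0, 1, 1]
  simp [qf] at h0 h1 h2 h3 h4 h5
  simp only [h0, h1, h2, zero_add] at h3 h4 h5
  ext i
  fin_cases i <;> simp [*]

end counting

section moments
open Classical
set_option linter.unusedSectionVars false

variable {F : Type*} [Field F] [Fintype F]

instance planeFintype : Fintype (Plane F) :=
  haveI : Finite (Plane F) := inferInstance
  Fintype.ofFinite _

lemma sum_proj (rep : Plane F → (Fin 3 → F))
    (hrep : ∀ p : Plane F, ∃ h : rep p ≠ 0, Projectivization.mk F (rep p) h = p)
    (h : (Fin 3 → F) → ℕ) (hh : ∀ (c : Fˣ) x, h (c • x) = h x) :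
    ∑ x, h x = (Fintype.card F - 1) * ∑ p, h (rep p) + h 0 := by
  rw [← Finset.sum_erase_add _ _ (Finset.mem_univ 0)]
  congr 1
  have e1 : (Fintype.card F - 1) * ∑ p, h (rep p) = ∑ cp : Fˣ × Plane F, h (cp.1 • rep cp.2) := by
    rw [Fintype.sum_prod_type]
    simp only [hh]
    simp [Fintype.card_units]
  rw [e1]
  symm
  refine Finset.sum_bij (fun cp _ => cp.1 • rep cp.2) ?_ ?_ ?_ ?_
  · rintro ⟨c, p⟩ -
    obtain ⟨hp, -⟩ := hrep p
    simp only [Finset.mem_erase, Finset.mem_univ, and_true]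
    exact (smul_ne_zero_iff_ne c).mpr hp
  · rintro ⟨c, p⟩ - ⟨c', p'⟩ - hcc
    obtain ⟨hp, ep⟩ := hrep p
    obtain ⟨hp', ep'⟩ := hrep p'
    simp only at hcc
    have : p = p' := by
      rw [← ep, ← ep', Projectivization.mk_eq_mk_iff]
      refine ⟨c⁻¹ * c', ?_⟩
      rw [mul_smul, ← hcc, inv_smul_smul]
    subst this
    congr 1
    ext
    exact smul_left_injective F hp hcc
  · intro x hx
    have hx0 : x ≠ 0 := by simpa using hx
    obtain ⟨hp, ep⟩ := hrep (Projectivization.mk F x hx0)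
    rw [Projectivization.mk_eq_mk_iff] at ep
    obtain ⟨c, hc⟩ := ep
    refine ⟨⟨c⁻¹, Projectivization.mk F x hx0⟩, Finset.mem_univ _, ?_⟩
    simp only
    rw [← hc, inv_smul_smul]
  · intros; rfl

lemma card_plane (rep : Plane F → (Fin 3 → F))
    (hrep : ∀ p : Plane F, ∃ h : rep p ≠ 0, Projectivization.mk F (rep p) h = p) :
    Fintype.card (Plane F) = Fintype.card F ^ 2 + Fintype.card F + 1 := by
  have h := sum_proj rep hrep (fun _ => 1) (by simp)
  simp at h
  have hq : 1 < Fintype.card F := Fintype.one_lt_card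
  obtain ⟨k, hk⟩ : ∃ k, Fintype.card F = k + 2 := ⟨Fintype.card F - 2, by omega⟩
  rw [hk] at h ⊢
  have : (k + 1) * Fintype.card (Plane F) = (k + 1) * ((k + 2) ^ 2 + (k + 2) + 1) := by
    have e : k + 2 - 1 = k + 1 := by omega
    rw [e] at h
    zify at h ⊢
    linear_combination -h
  exact Nat.eq_of_mul_eq_mul_left (by omega) this

lemma qf_smul (a : Fin 6 → F) (c : F) (x : Fin 3 → F) : qf a (c • x) = c ^ 2 * qf a x := by
  simp [qf]; ring

/-- Number of projective zeros of a quadratic form. -/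
def nz (rep : Plane F → (Fin 3 → F)) (a : Fin 6 → F) : ℕ :=
  ∑ p, if qf a (rep p) = 0 then 1 else 0

lemma nz_mem (rep : Plane F → (Fin 3 → F))
    (hrep : ∀ p : Plane F, ∃ h : rep p ≠ 0, Projectivization.mk F (rep p) h = p)
    (a : Fin 6 → F) (ha : a ≠ 0) :
    nz rep a = 1 ∨ nz rep a = Fintype.card F + 1 ∨ nz rep a = 2 * Fintype.card F + 1 := by
  have h := sum_proj rep hrep (fun x => if qf a x = 0 then 1 else 0) (by
    intro c x
    have : qf a (c • x) = (c : F) ^ 2 * qf a x := qf_smul a c x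
    simp [this])
  have h0 : qf a 0 = 0 := by simp [qf]
  simp only [h0, if_true] at h
  change _ = (Fintype.card F - 1) * nz rep a + 1 at h
  have h2 := (affine_count a).resolve_left (fun h => ha (qf_eq_zero a h))
  rw [h] at h2
  have hq : 1 < Fintype.card F := Fintype.one_lt_card
  generalize nz rep a = n at *
  generalize Fintype.card F = q at *
  obtain ⟨k, rfl⟩ : ∃ k, q = k + 2 := ⟨q - 2, by omega⟩
  have e : k + 2 - 1 = k + 1 := by omega
  simp only [Set.mem_insert_iff, Set.mem_singleton_iff, e] at h2
  have cancel : ∀ m, (k + 1) * n = (k + 1) * m → n = m := fun m hm =>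
    Nat.eq_of_mul_eq_mul_left (by omega) hm
  rcases h2 with h2 | h2 | h2
  · left; apply cancel; omega
  · right; left; apply cancel; zify at h2 ⊢; linear_combination h2
  · right; right; apply cancel
    zify [show k + 2 ≤ 2 * (k + 2) ^ 2 by nlinarith] at h2 ⊢; linear_combination h2

/-- Evaluation at a vector as a linear functional in the coefficients. -/
def evq (x : Fin 3 → F) : (Fin 6 → F) →ₗ[F] F where
  toFun a := qf a x
  map_add' a b := by simp [qf]; ring
  map_smul' c a := by simp [qf]; ring

lemma card_ker {W : Type*} [AddCommGroup W] [Module F W] (φ : (Fin 6 → F) →ₗ[F] W)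
    (hφ : Function.Surjective φ) (k : ℕ) (hk : Module.finrank F W + k = 6) :
    (∑ a, if φ a = 0 then 1 else 0) = Fintype.card F ^ k := by
  have h1 := φ.finrank_range_add_finrank_ker
  rw [LinearMap.range_eq_top.mpr hφ, finrank_top] at h1
  have h2 : Module.finrank F (Fin 6 → F) = 6 := by simp
  have h3 : Module.finrank F (LinearMap.ker φ) = k := by omega
  rw [← h3, ← Module.card_eq_pow_finrank, ← Finset.card_filter, ← Fintype.card_subtype]
  exact Fintype.card_congr (Equiv.refl _)

lemma exists_form {v : Fin 3 → F} {S : Submodule F (Fin 3 → F)} (hv : v ∉ S) :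
    ∃ a, qf a v ≠ 0 ∧ ∀ w ∈ S, qf a w = 0 := by
  obtain ⟨f, hf, hS⟩ := Submodule.exists_le_ker_of_notMem hv
  have hl : ∀ x : Fin 3 → F, f x = x 0 * f (Pi.single 0 1) + x 1 * f (Pi.single 1 1)
      + x 2 * f (Pi.single 2 1) := by
    intro x
    rw [LinearMap.pi_apply_eq_sum_univ f x, Fin.sum_univ_three]
    have e : ∀ i : Fin 3, (fun j => if i = j then (1 : F) else 0) = Pi.single i 1 := by
      intro i; ext j; simp [Pi.single_apply, eq_comm]
    simp [e]
  have hq : ∀ x, qf ![f (Pi.single 0 1) ^ 2, f (Pi.single 1 1) ^ 2, f (Pi.single 2 1) ^ 2,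
      2 * f (Pi.single 0 1) * f (Pi.single 1 1), 2 * f (Pi.single 0 1) * f (Pi.single 2 1),
      2 * f (Pi.single 1 1) * f (Pi.single 2 1)] x = f x ^ 2 := by
    intro x
    rw [hl x]
    simp [qf]; ring
  obtain ⟨a, ha⟩ : ∃ a, ∀ x, qf a x = f x ^ 2 := ⟨_, hq⟩
  refine ⟨a, ?_, ?_⟩
  · rw [ha]; exact pow_ne_zero _ hf
  · intro w hw
    rw [ha, show f w = 0 from hS hw]; simp

lemma count_one {v : Fin 3 → F} (hv : v ≠ 0) :
    (∑ a, if qf a v = 0 then 1 else 0) = Fintype.card F ^ 5 := by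
  obtain ⟨a, ha, -⟩ := exists_form (F := F) (v := v) (S := ⊥) (by simpa using hv)
  apply card_ker (evq v)
  · intro c
    refine ⟨(c / qf a v) • a, ?_⟩
    rw [map_smul]
    change c / qf a v * qf a v = c
    field_simp
  · simp

lemma count_two {v w : Fin 3 → F} (hv : v ∉ Submodule.span F {w})
    (hw : w ∉ Submodule.span F {v}) :
    (∑ a, if qf a v = 0 ∧ qf a w = 0 then 1 else 0) = Fintype.card F ^ 4 := by
  obtain ⟨a, ha, ha'⟩ := exists_form hv
  obtain ⟨b, hb, hb'⟩ := exists_form hw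
  replace ha' := ha' w (Submodule.mem_span_singleton_self w)
  replace hb' := hb' v (Submodule.mem_span_singleton_self v)
  rw [← card_ker ((evq v).prod (evq w))]
  · simp [evq]
  · rintro ⟨c, d⟩
    refine ⟨(c / qf a v) • a + (d / qf b w) • b, ?_⟩
    rw [map_add, map_smul, map_smul]
    simp [evq, ha, hb, ha', hb']
  · simp

lemma moment_one (rep : Plane F → (Fin 3 → F))
    (hrep : ∀ p : Plane F, ∃ h : rep p ≠ 0, Projectivization.mk F (rep p) h = p) :
    ∑ a, nz rep a = Fintype.card (Plane F) * Fintype.card F ^ 5 := by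
  unfold nz
  rw [Finset.sum_comm]
  rw [Finset.sum_congr rfl (fun p _ => count_one (hrep p).1)]
  simp

lemma moment_two (rep : Plane F → (Fin 3 → F))
    (hrep : ∀ p : Plane F, ∃ h : rep p ≠ 0, Projectivization.mk F (rep p) h = p) :
    ∑ a, nz rep a ^ 2 = Fintype.card (Plane F) * (Fintype.card F ^ 5 +
      (Fintype.card (Plane F) - 1) * Fintype.card F ^ 4) := by
  have e : ∀ a, nz rep a ^ 2 = ∑ p, ∑ p', if qf a (rep p) = 0 ∧ qf a (rep p') = 0 then 1 else 0 := by
    intro a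
    rw [nz, sq, Finset.sum_mul_sum]
    refine Finset.sum_congr rfl fun p _ => Finset.sum_congr rfl fun p' _ => ?_
    by_cases h : qf a (rep p) = 0 <;> by_cases h' : qf a (rep p') = 0 <;> simp [h, h']
  have key : ∀ p p', p ∉ ({p'} : Set (Plane F)) → rep p ∉ Submodule.span F {rep p'} := by
    intro p p' hp hm
    apply hp
    obtain ⟨h, ep⟩ := hrep p
    obtain ⟨h', ep'⟩ := hrep p'
    obtain ⟨c, hc⟩ := Submodule.mem_span_singleton.mp hm
    rw [Set.mem_singleton_iff, ← ep, ← ep', Projectivization.mk_eq_mk_iff']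
    exact ⟨c, hc⟩
  simp only [e]
  rw [Finset.sum_comm]
  have : ∀ p, (∑ a, ∑ p', if qf a (rep p) = 0 ∧ qf a (rep p') = 0 then 1 else 0)
      = Fintype.card F ^ 5 + (Fintype.card (Plane F) - 1) * Fintype.card F ^ 4 := by
    intro p
    rw [Finset.sum_comm, ← Finset.add_sum_erase _ _ (Finset.mem_univ p)]
    congr 1
    · simp only [and_self]
      exact count_one (hrep p).1
    · rw [Finset.sum_congr rfl (g := fun _ => Fintype.card F ^ 4)]
      · simp [Finset.card_erase_of_mem]
      · intro p' hp'
        have := Finset.ne_of_mem_erase hp'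
        exact count_two (key _ _ (by simpa using this.symm)) (key _ _ (by simpa using this))
  simp only [this]
  simp

/-- Number of nonzero forms with `n` projective zeros. -/
def cnt (rep : Plane F → (Fin 3 → F)) (n : ℕ) : ℕ :=
  (Finset.univ.filter fun a : Fin 6 → F => a ≠ 0 ∧ nz rep a = n).card

lemma sum_moment (rep : Plane F → (Fin 3 → F))
    (hrep : ∀ p : Plane F, ∃ h : rep p ≠ 0, Projectivization.mk F (rep p) h = p) (g : ℕ → ℕ) :
    ∑ a, g (nz rep a) = g (Fintype.card (Plane F)) + g 1 * cnt rep 1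
      + g (Fintype.card F + 1) * cnt rep (Fintype.card F + 1)
      + g (2 * Fintype.card F + 1) * cnt rep (2 * Fintype.card F + 1) := by
  have hq : 1 < Fintype.card F := Fintype.one_lt_card
  have h0 : nz rep (0 : Fin 6 → F) = Fintype.card (Plane F) := by simp [nz, qf]
  have e : ∀ a, g (nz rep a) = (if a = 0 then g (Fintype.card (Plane F)) else 0)
      + g 1 * (if a ≠ 0 ∧ nz rep a = 1 then 1 else 0)
      + g (Fintype.card F + 1) * (if a ≠ 0 ∧ nz rep a = Fintype.card F + 1 then 1 else 0)
      + g (2 * Fintype.card F + 1) *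
        (if a ≠ 0 ∧ nz rep a = 2 * Fintype.card F + 1 then 1 else 0) := by
    intro a
    by_cases ha : a = 0
    · subst ha; simp [h0]
    · have a1 : Fintype.card F ≠ 0 := by omega
      have a2 : Fintype.card F ≠ 2 * Fintype.card F := by omega
      rcases nz_mem rep hrep a ha with h | h | h <;> simp [h, ha, a1, a2, a2.symm]
  rw [Finset.sum_congr rfl (fun a _ => e a)]
  simp only [Finset.sum_add_distrib, ← Finset.mul_sum, cnt, Finset.card_filter]
  simp

lemma cnt_values (rep : Plane F → (Fin 3 → F))
    (hrep : ∀ p : Plane F, ∃ h : rep p ≠ 0, Projectivization.mk F (rep p) h = p)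
    (q : ℚ) (hqq : (Fintype.card F : ℚ) = q) :
    (cnt rep (2 * Fintype.card F + 1) : ℚ) = (q - 1) * ((q ^ 4 + 2 * q ^ 3 + 2 * q ^ 2 + q) / 2) ∧
    (cnt rep (Fintype.card F + 1) : ℚ) = (q - 1) * (q ^ 5 + q + 1) ∧
    (cnt rep 1 : ℚ) = (q - 1) * ((q ^ 4 - q) / 2) := by
  have m0 := sum_moment rep hrep (fun _ => 1)
  have m1 := sum_moment rep hrep (fun n => n)
  have m2 := sum_moment rep hrep (fun n => n ^ 2)
  rw [moment_one rep hrep] at m1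
  rw [moment_two rep hrep] at m2
  simp at m0
  rw [card_plane rep hrep] at m1 m2
  rw [Nat.add_sub_cancel] at m2
  have hq0 : q ≠ 0 := by
    rw [← hqq]
    exact_mod_cast Fintype.card_ne_zero
  generalize cnt rep 1 = n1 at *
  generalize cnt rep (Fintype.card F + 1) = n2 at *
  generalize cnt rep (2 * Fintype.card F + 1) = n3 at *
  have M0 : (q ^ 6 : ℚ) = 1 + n1 + n2 + n3 := by rw [← hqq]; exact_mod_cast m0
  have M1 : ((q ^ 2 + q + 1) * q ^ 5 : ℚ)
      = (q ^ 2 + q + 1) + n1 + (q + 1) * n2 + (2 * q + 1) * n3 := by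
    rw [← hqq]; push_cast [← @Nat.cast_inj ℚ] at m1; linear_combination m1
  have M2 : ((q ^ 2 + q + 1) * (q ^ 5 + (q ^ 2 + q) * q ^ 4) : ℚ)
      = (q ^ 2 + q + 1) ^ 2 + n1 + (q + 1) ^ 2 * n2 + (2 * q + 1) ^ 2 * n3 := by
    rw [← hqq]; push_cast [← @Nat.cast_inj ℚ] at m2; linear_combination m2
  have K3 : (n3 : ℚ) = (q - 1) * ((q ^ 4 + 2 * q ^ 3 + 2 * q ^ 2 + q) / 2) := by
    have : (2 * q ^ 2) * (n3 : ℚ)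
        = (2 * q ^ 2) * ((q - 1) * ((q ^ 4 + 2 * q ^ 3 + 2 * q ^ 2 + q) / 2)) := by
      linear_combination -(M2 - (2 + q) * M1 + (1 + q) * M0)
    exact mul_left_cancel₀ (by positivity) this
  have K2 : (n2 : ℚ) = (q - 1) * (q ^ 5 + q + 1) := by
    have : q * (n2 : ℚ) = q * ((q - 1) * (q ^ 5 + q + 1)) := by
      linear_combination M0 - M1 - 2 * q * K3
    exact mul_left_cancel₀ hq0 this
  refine ⟨K3, K2, ?_⟩
  linear_combination -M0 - K2 - K3

end moments

section final
open Classical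
set_option linter.unusedSectionVars false

variable {F : Type*} [Field F] [Fintype F]

/-- The codeword of a coefficient vector. -/
def cw (rep : Plane F → (Fin 3 → F)) : (Fin 6 → F) →ₗ[F] (Plane F → F) :=
  LinearMap.pi fun p => evq (rep p)

lemma cw_apply (rep : Plane F → (Fin 3 → F)) (a : Fin 6 → F) (p : Plane F) :
    cw rep a p = qf a (rep p) := rfl

lemma poly_eval (f : MvPolynomial (Fin 3) F) (hf : f.IsHomogeneous 2) :
    ∃ a : Fin 6 → F, ∀ x : Fin 3 → F, aeval x f = qf a x := by
  let R : Submodule F ((Fin 3 → F) → F) := LinearMap.range (LinearMap.pi fun x => evq x)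
  have hR : (fun x => aeval x f) ∈ R := by
    have : (fun x : Fin 3 → F => aeval x f)
        = ∑ d ∈ f.support, (f.coeff d) • fun x : Fin 3 → F => ∏ i, x i ^ d i := by
      ext x
      rw [aeval_eq_eval, eval_eq']
      simp
    rw [this]
    refine Submodule.sum_mem _ fun d hd => Submodule.smul_mem _ _ ?_
    have hdeg : d 0 + d 1 + d 2 = 2 := by
      have := hf (mem_support_iff.mp hd)
      rw [Finsupp.weight_apply, Finsupp.sum_fintype _ _ (by simp)] at this
      simpa [Fin.sum_univ_three] using this
    have hcase : (d 0 = 2 ∧ d 1 = 0 ∧ d 2 = 0) ∨ (d 0 = 0 ∧ d 1 = 2 ∧ d 2 = 0) ∨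
      (d 0 = 0 ∧ d 1 = 0 ∧ d 2 = 2) ∨ (d 0 = 1 ∧ d 1 = 1 ∧ d 2 = 0) ∨
      (d 0 = 1 ∧ d 1 = 0 ∧ d 2 = 1) ∨ (d 0 = 0 ∧ d 1 = 1 ∧ d 2 = 1) := by omega
    have mk : ∀ i : Fin 6, (∀ x : Fin 3 → F, qf (Pi.single i 1) x = ∏ i, x i ^ d i) →
        (fun x : Fin 3 → F => ∏ i, x i ^ d i) ∈ R := fun i hi =>
      ⟨Pi.single i 1, funext hi⟩
    rcases hcase with h | h | h | h | h | h
    · exact mk 0 fun x => by simp [qf, Fin.prod_univ_three, h]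
    · exact mk 1 fun x => by simp [qf, Fin.prod_univ_three, h]
    · exact mk 2 fun x => by simp [qf, Fin.prod_univ_three, h]
    · exact mk 3 fun x => by simp [qf, Fin.prod_univ_three, h]
    · exact mk 4 fun x => by simp [qf, Fin.prod_univ_three, h]
    · exact mk 5 fun x => by simp [qf, Fin.prod_univ_three, h]
  obtain ⟨a, ha⟩ := hR
  exact ⟨a, fun x => (congrFun ha x).symm⟩

lemma code_eq (rep : Plane F → (Fin 3 → F)) : VeroneseCode rep = LinearMap.range (cw rep) := by
  ext g
  constructor
  · rintro ⟨f, hf, rfl⟩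
    obtain ⟨a, ha⟩ := poly_eval f ((mem_homogeneousSubmodule 2 f).mp hf)
    exact ⟨a, funext fun p => (ha (rep p)).symm⟩
  · rintro ⟨a, rfl⟩
    refine Submodule.mem_map.mpr ⟨qpoly a, (mem_homogeneousSubmodule 2 _).mpr (qpoly_hom a), ?_⟩
    ext p
    rw [LinearMap.pi_apply, AlgHom.toLinearMap_apply, aeval_qpoly, cw_apply]

lemma wtSub_eq (rep : Plane F → (Fin 3 → F)) (a : Fin 6 → F) :
    wtSub (Submodule.span F {cw rep a}) + nz rep a = Fintype.card (Plane F) := by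
  have : {p | ∃ c ∈ Submodule.span F {cw rep a}, c p ≠ 0} = {p | ¬ qf a (rep p) = 0} := by
    ext p
    constructor
    · rintro ⟨c, hc, hp⟩ h
      obtain ⟨t, rfl⟩ := Submodule.mem_span_singleton.mp hc
      apply hp
      simp [cw_apply, h]
    · intro h
      exact ⟨_, Submodule.mem_span_singleton_self _, h⟩
  rw [wtSub, this, nz, ← Finset.card_filter, Nat.card_eq_fintype_card, add_comm]
  simp only [Set.coe_ofPred, Fintype.card_subtype]
  rw [Finset.card_filter_add_card_filter_not, Finset.card_univ]

lemma cw_inj (rep : Plane F → (Fin 3 → F))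
    (hrep : ∀ p : Plane F, ∃ h : rep p ≠ 0, Projectivization.mk F (rep p) h = p) :
    Function.Injective (cw rep) := by
  rw [injective_iff_map_eq_zero]
  intro a ha
  by_contra h0
  have h1 : nz rep a = Fintype.card (Plane F) := by
    have : ∀ p, qf a (rep p) = 0 := fun p => congrFun ha p
    simp [nz, this]
  have h2 := nz_mem rep hrep a h0
  have hq : 1 < Fintype.card F := Fintype.one_lt_card
  rw [h1, card_plane rep hrep] at h2
  rcases h2 with h | h | h <;> nlinarith

lemma spectrum_count (rep : Plane F → (Fin 3 → F))
    (hrep : ∀ p : Plane F, ∃ h : rep p ≠ 0, Projectivization.mk F (rep p) h = p) (w : ℕ) :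
    hwSpectrum rep 1 w * (Fintype.card F - 1) =
      (Finset.univ.filter fun a : Fin 6 → F =>
        a ≠ 0 ∧ w + nz rep a = Fintype.card (Plane F)).card := by
  have hinj := cw_inj rep hrep
  let 𝒟 := {D : Submodule F (Plane F → F) //
    D ≤ VeroneseCode rep ∧ Module.finrank F ↥D = 1 ∧ wtSub D = w}
  have : Fintype 𝒟 := Fintype.ofFinite _
  have h1 : hwSpectrum rep 1 w = Fintype.card 𝒟 := Nat.card_eq_fintype_card
  have hspan : ∀ (D : Submodule F (Plane F → F)), Module.finrank F D = 1 → ∀ c ∈ D, c ≠ 0 →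
      Submodule.span F {c} = D := by
    intro D hD c hc hc0
    apply Submodule.eq_of_le_of_finrank_eq
    · simpa using hc
    · rw [finrank_span_singleton hc0, hD]
  have h2 : ∀ D : 𝒟, Fintype.card {c : D.1 // c ≠ 0} = Fintype.card F - 1 := by
    intro D
    have : Fintype.card {c : D.1 // c ≠ 0} = Fintype.card D.1 - 1 := by
      simp [Fintype.card_subtype_compl]
    rw [this, Module.card_eq_pow_finrank (K := F), D.2.2.1, pow_one]
  have h3 : Fintype.card (Σ D : 𝒟, {c : D.1 // c ≠ 0}) =
      hwSpectrum rep 1 w * (Fintype.card F - 1) := by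
    rw [Fintype.card_sigma]
    simp only [h2]
    simp [h1]
  rw [← h3, ← Fintype.card_subtype]
  symm
  have hne : ∀ a : Fin 6 → F, a ≠ 0 → cw rep a ≠ 0 := fun a ha h =>
    ha (hinj (by rw [h, map_zero]))
  have hw : ∀ a : Fin 6 → F, wtSub (Submodule.span F {cw rep a}) = w ↔
      w + nz rep a = Fintype.card (Plane F) := by
    intro a
    have := wtSub_eq rep a
    omega
  let φ : {a : Fin 6 → F // a ≠ 0 ∧ w + nz rep a = Fintype.card (Plane F)} →
      (Σ D : 𝒟, {c : D.1 // c ≠ 0}) := fun a =>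
    ⟨⟨Submodule.span F {cw rep a.1}, by
      rw [code_eq, Submodule.span_singleton_le_iff_mem]
      exact ⟨a.1, rfl⟩, finrank_span_singleton (hne _ a.2.1), (hw _).mpr a.2.2⟩,
      ⟨⟨cw rep a.1, Submodule.mem_span_singleton_self _⟩, fun h =>
        hne _ a.2.1 (congrArg Subtype.val h)⟩⟩
  apply Fintype.card_of_bijective (f := φ)
  constructor
  · intro a b hab
    have : ∀ s t : (Σ D : 𝒟, {c : D.1 // c ≠ 0}), s = t → s.2.1.1 = t.2.1.1 := by
      rintro s _ rfl; rfl
    exact Subtype.ext (hinj (this _ _ hab))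
  · rintro ⟨⟨D, hD1, hD2, hD3⟩, ⟨⟨c, hc⟩, hc0⟩⟩
    have hc0' : c ≠ 0 := fun h => hc0 (Subtype.ext h)
    have hs := hspan D hD2 c hc hc0'
    have hcC := hD1 hc
    rw [code_eq] at hcC
    obtain ⟨a, rfl⟩ := hcC
    subst hs
    refine ⟨⟨a, fun h => hc0' (by rw [h, map_zero]), (hw a).mp hD3⟩, rfl⟩

end final

theorem veronese_spectrum_dim_one
    {F : Type*} [Field F] [Fintype F] (q : ℕ) (hq : Fintype.card F = q) (hq4 : 4 ≤ q)
    (rep : Plane F → (Fin 3 → F))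
    (hrep : ∀ p : Plane F, ∃ h : rep p ≠ 0, Projectivization.mk F (rep p) h = p) :
    (hwSpectrum rep 1 (q ^ 2 - q) : ℚ) = ((q : ℚ) ^ 4 + 2 * q ^ 3 + 2 * q ^ 2 + q) / 2 ∧
    (hwSpectrum rep 1 (q ^ 2) : ℚ) = (q : ℚ) ^ 5 + q + 1 ∧
    (hwSpectrum rep 1 (q ^ 2 + q) : ℚ) = ((q : ℚ) ^ 4 - q) / 2 ∧
    ∀ w : ℕ, w ∉ ({q ^ 2 - q, q ^ 2, q ^ 2 + q} : Set ℕ) → hwSpectrum rep 1 w = 0 := by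
  classical
  have hP := card_plane rep hrep
  obtain ⟨c3, c2, c1⟩ := cnt_values rep hrep (q : ℚ) (by rw [hq])
  rw [hq] at hP c3 c2
  have hqq : q ≤ q ^ 2 := by nlinarith
  have hs : ∀ w n, w + n = q ^ 2 + q + 1 →
      (hwSpectrum rep 1 w : ℚ) * ((q : ℚ) - 1) = cnt rep n := by
    intro w n hwn
    have h := spectrum_count rep hrep w
    have e : (Finset.univ.filter fun a : Fin 6 → F =>
        a ≠ 0 ∧ w + nz rep a = Fintype.card (Plane F)).card = cnt rep n := by
      unfold cnt
      congr 1
      ext a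
      simp only [Finset.mem_filter, Finset.mem_univ, true_and, hP, ← hwn]
      constructor
      · rintro ⟨h, h'⟩; exact ⟨h, by omega⟩
      · rintro ⟨h, h'⟩; exact ⟨h, by omega⟩
    have h' : hwSpectrum rep 1 w * (Fintype.card F - 1) = cnt rep n := by
      rw [h, ← e]
    rw [← h', hq]
    push_cast [show 1 ≤ q by omega]
    ring
  have hq1 : (q : ℚ) - 1 ≠ 0 := by
    have : (4 : ℚ) ≤ q := by exact_mod_cast hq4
    intro h; linarith
  refine ⟨?_, ?_, ?_, ?_⟩
  · apply mul_right_cancel₀ hq1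
    rw [hs _ (2 * q + 1) (by omega), c3]; ring
  · apply mul_right_cancel₀ hq1
    rw [hs _ (q + 1) (by omega), c2]; ring
  · apply mul_right_cancel₀ hq1
    rw [hs _ 1 (by omega), c1]; ring
  · intro w hw
    have h := spectrum_count rep hrep w
    rw [Finset.filter_false_of_mem, Finset.card_empty] at h
    · rcases Nat.mul_eq_zero.mp h with h | h
      · exact h
      · omega
    · rintro a - ⟨ha, hn⟩
      apply hw
      simp only [Set.mem_insert_iff, Set.mem_singleton_iff]
      have := nz_mem rep hrep a ha
      rw [hP] at hn
      rw [hq] at this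
      omega
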